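/- Let p be a constant with 1 − 1/√2 < p < 1 (independent of n). Then asymptotically almost surely a random graph Γ ∈ G(n, p) simultaneously satisfies: (i) there is no ordered pair of distinct vertices (v, w) with lk(v) ⊆ st(w), and (ii) Γ is star 2-connected. -/

import Mathlib

open Finset Filter Topology

attribute [local instance] Classical.propDecidable

/-- The Erdős–Rényi weight of a graph `Γ` on `n` vertices with edge probability `p`:
`p^{E_Γ} (1-p)^{C(n,2) - E_Γ}`. -/
noncomputable def gnpWeight (n : ℕ) (p : ℝ) (Γ : SimpleGraph (Fin n)) : ℝ :=
  p ^ Γ.edgeSet.ncard * (1 - p) ^ (n.choose 2 - Γ.edgeSet.ncard)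

/-- The probability of the event `A` under the Erdős–Rényi model `G(n,p)`. -/
noncomputable def gnpProb (n : ℕ) (p : ℝ) (A : SimpleGraph (Fin n) → Prop) : ℝ :=
  ∑ Γ : SimpleGraph (Fin n), if A Γ then gnpWeight n p Γ else 0

/-- The expectation of a random variable `X` under the Erdős–Rényi model `G(n,p)`. -/
noncomputable def gnpExp (n : ℕ) (p : ℝ) (X : SimpleGraph (Fin n) → ℝ) : ℝ :=
  ∑ Γ : SimpleGraph (Fin n), gnpWeight n p Γ * X Γ

/-- `lk(v) ⊆ st(w)`: every vertex adjacent to `v` either equals `w` or is adjacent to `w`. -/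
def LinkSubsetStar {V : Type*} (Γ : SimpleGraph V) (v w : V) : Prop :=
  ∀ u : V, Γ.Adj v u → (u = w ∨ Γ.Adj w u)

/-- A graph is star 2-connected if there is no vertex `v` and no partition of the
vertices outside `st(v)` into two nonempty sets `S`, `T` with no edge joining `S` to `T`. -/
def StarTwoConnected {n : ℕ} (Γ : SimpleGraph (Fin n)) : Prop :=
  ¬ ∃ (v : Fin n) (S T : Finset (Fin n)),
      S.Nonempty ∧ T.Nonempty ∧ Disjoint S T ∧
      (∀ u : Fin n, u ∈ S ∪ T ↔ (u ≠ v ∧ ¬ Γ.Adj v u)) ∧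
      (∀ s ∈ S, ∀ t ∈ T, ¬ Γ.Adj s t)

/-- The expectation of `h` over a random subset of `G` in which every element is present
independently with probability `p`. -/
noncomputable def randomSubsetExp {α : Type*} (p : ℝ) (G : Finset α) (h : Finset α → ℝ) : ℝ :=
  ∑ E ∈ G.powerset, p ^ E.card * (1 - p) ^ (G.card - E.card) * h E

lemma randomSubsetExp_congr {α : Type*} {p : ℝ} {G : Finset α} {h k : Finset α → ℝ}
    (H : ∀ E ⊆ G, h E = k E) : randomSubsetExp p G h = randomSubsetExp p G k :=
  Finset.sum_congr rfl fun E hE => by rw [H E (Finset.mem_powerset.1 hE)]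

lemma randomSubsetExp_zero {α : Type*} (p : ℝ) (G : Finset α) :
    randomSubsetExp p G (fun _ => 0) = 0 := by
  simp [randomSubsetExp]

lemma randomSubsetExp_one {α : Type*} (p : ℝ) (G : Finset α) :
    randomSubsetExp p G (fun _ => 1) = 1 := by
  simp [randomSubsetExp, Finset.sum_pow_mul_eq_add_pow]

lemma randomSubsetExp_insert {α : Type*} (p : ℝ) {G : Finset α} {e : α} (he : e ∉ G)
    (h : Finset α → ℝ) :
    randomSubsetExp p (insert e G) h =
      (1 - p) * randomSubsetExp p G h + p * randomSubsetExp p G (fun E => h (insert e E)) := by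
  unfold randomSubsetExp
  rw [Finset.sum_powerset_insert he, Finset.mul_sum, Finset.mul_sum]
  congr 1 <;> refine Finset.sum_congr rfl fun E hE => ?_
  · have hE := Finset.card_le_card (Finset.mem_powerset.1 hE)
    rw [Finset.card_insert_of_notMem he, Nat.succ_sub hE, pow_succ]
    ring
  · have heE : e ∉ E := fun h' => he (Finset.mem_powerset.1 hE h')
    rw [Finset.card_insert_of_notMem he, Finset.card_insert_of_notMem heE,
      Nat.add_sub_add_right, pow_succ]
    ring

/-- The probability that none of a family of disjoint triples meets the random subset in exactly
its last two elements. -/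
lemma randomSubsetExp_avoid {ι α : Type*} (p : ℝ) (f : ι → Fin 3 → α) (hf : Function.Injective2 f)
    (U : Finset ι) : ∀ G : Finset α, (∀ u ∈ U, ∀ i, f u i ∈ G) →
      randomSubsetExp p G
        (fun E => if ∀ u ∈ U, ¬ (f u 0 ∉ E ∧ f u 1 ∈ E ∧ f u 2 ∈ E) then 1 else 0) =
        (1 - (1 - p) * p ^ 2) ^ U.card := by
  induction U using Finset.induction_on with
  | empty => intro G _; simp [randomSubsetExp_one]
  | insert u U hu ih =>
    intro G hG
    have hne : ∀ i j, i ≠ j → f u i ≠ f u j := fun i j hij h => hij (hf h).2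
    have h01 := hne 0 1 (by decide)
    have h02 := hne 0 2 (by decide)
    have h12 := hne 1 2 (by decide)
    have hout : ∀ v ∈ U, ∀ i j, f v i ≠ f u j := fun v hv i j h => hu ((hf h).1 ▸ hv)
    set G' := ((G.erase (f u 0)).erase (f u 1)).erase (f u 2) with hG'
    have hmem := hG u (Finset.mem_insert_self u U)
    have hGe : G = insert (f u 0) (insert (f u 1) (insert (f u 2) G')) := by
      rw [hG', Finset.insert_erase, Finset.insert_erase, Finset.insert_erase (hmem 0)]
      · simp [h01.symm, hmem]
      · simp [h02.symm, h12.symm, hmem]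
    have n0 : f u 0 ∉ G' := by simp [hG']
    have n1 : f u 1 ∉ G' := by simp [hG']
    have n2 : f u 2 ∉ G' := by simp [hG']
    have key := ih G' fun v hv i => by
      simp [hG', hout v hv, hG v (Finset.mem_insert_of_mem hv)]
    clear_value G'
    subst hGe
    have n12 : f u 1 ∉ insert (f u 2) G' := by simp [h12, n1]
    have n012 : f u 0 ∉ insert (f u 1) (insert (f u 2) G') := by simp [h01, h02, n0]
    rw [randomSubsetExp_insert p n012, randomSubsetExp_insert p n12, randomSubsetExp_insert p n12,
      randomSubsetExp_insert p n2, randomSubsetExp_insert p n2,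
      randomSubsetExp_insert p n2, randomSubsetExp_insert p n2,
      Finset.card_insert_of_notMem hu, pow_succ, ← key]
    have hsimp : ∀ F : Finset α → Finset α,
        (∀ E, ∀ v ∈ U, ∀ i, f v i ∈ F E ↔ f v i ∈ E) →
        (∀ E ⊆ G', ¬ (f u 0 ∉ F E ∧ f u 1 ∈ F E ∧ f u 2 ∈ F E)) →
        randomSubsetExp p G' (fun E => if ∀ v ∈ insert u U,
          ¬ (f v 0 ∉ F E ∧ f v 1 ∈ F E ∧ f v 2 ∈ F E) then 1 else 0) =
        randomSubsetExp p G' (fun E => if ∀ v ∈ U,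
          ¬ (f v 0 ∉ E ∧ f v 1 ∈ E ∧ f v 2 ∈ E) then 1 else 0) := by
      intro F h1 h2
      refine randomSubsetExp_congr fun E hE => ?_
      congr 1
      rw [Finset.forall_mem_insert, eq_iff_iff, and_iff_right (h2 E hE)]
      exact forall₂_congr fun v hv => by simp only [h1 E v hv]
    have hbad : randomSubsetExp p G' (fun E => if ∀ v ∈ insert u U,
          ¬ (f v 0 ∉ insert (f u 1) (insert (f u 2) E) ∧
            f v 1 ∈ insert (f u 1) (insert (f u 2) E) ∧
            f v 2 ∈ insert (f u 1) (insert (f u 2) E)) then 1 else 0) = 0 := by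
      refine (randomSubsetExp_congr fun E hE => if_neg fun h => ?_).trans
        (randomSubsetExp_zero p G')
      refine h u (Finset.mem_insert_self u U) ⟨?_, by simp, by simp⟩
      simp only [Finset.mem_insert, h01, h02, false_or]
      exact fun h => n0 (hE h)
    have m1 : ∀ E ⊆ G', f u 1 ∉ E := fun E hE h => n1 (hE h)
    have m2 : ∀ E ⊆ G', f u 2 ∉ E := fun E hE h => n2 (hE h)
    rw [hbad, hsimp (fun E => E), hsimp (fun E => insert (f u 2) E),
      hsimp (fun E => insert (f u 1) E), hsimp (fun E => insert (f u 0) E),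
      hsimp (fun E => insert (f u 0) (insert (f u 2) E)),
      hsimp (fun E => insert (f u 0) (insert (f u 1) E)),
      hsimp (fun E => insert (f u 0) (insert (f u 1) (insert (f u 2) E)))]
    · ring
    all_goals first
      | (intro E v hv i; simp [hout v hv])
      | (intro E hE; simp [m1 E hE, m2 E hE, h12, h12.symm])

lemma gnpProb_eq_randomSubsetExp (n : ℕ) (p : ℝ) (A : SimpleGraph (Fin n) → Prop) :
    gnpProb n p A = randomSubsetExp p (⊤ : SimpleGraph (Fin n)).edgeFinset
      (fun E => if A (SimpleGraph.fromEdgeSet (E : Set (Sym2 (Fin n)))) then 1 else 0) := by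
  unfold gnpProb randomSubsetExp
  refine Finset.sum_bij' (fun Γ _ => Γ.edgeFinset)
    (fun E _ => SimpleGraph.fromEdgeSet (E : Set (Sym2 (Fin n)))) ?_ ?_ ?_ ?_ ?_
  · intro Γ _
    rw [Finset.mem_powerset]
    exact SimpleGraph.edgeFinset_mono le_top
  · simp
  · intro Γ _
    simp
  · intro E hE
    ext e
    have : e ∈ E → _ := fun h => Finset.mem_powerset.1 hE h
    simp only [SimpleGraph.mem_edgeFinset, SimpleGraph.edgeSet_fromEdgeSet] at this ⊢
    simp only [SimpleGraph.edgeSet_top] at this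
    simpa using this
  · intro Γ _
    rw [SimpleGraph.card_edgeFinset_top_eq_card_choose_two, Fintype.card_fin]
    simp only [SimpleGraph.coe_edgeFinset, SimpleGraph.fromEdgeSet_edgeSet, mul_ite, mul_one,
      mul_zero]
    simp only [gnpWeight, Set.ncard_eq_toFinset_card', SimpleGraph.edgeFinset]

lemma gnpProb_true (n : ℕ) (p : ℝ) : gnpProb n p (fun _ => True) = 1 := by
  simpa [randomSubsetExp_one] using gnpProb_eq_randomSubsetExp n p fun _ => True

lemma gnpProb_add_gnpProb_not (n : ℕ) (p : ℝ) (A : SimpleGraph (Fin n) → Prop) :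
    gnpProb n p A + gnpProb n p (fun Γ => ¬ A Γ) = 1 := by
  rw [← gnpProb_true n p]
  unfold gnpProb
  rw [← Finset.sum_add_distrib]
  refine Finset.sum_congr rfl fun Γ _ => ?_
  by_cases h : A Γ <;> simp [h]

lemma gnpWeight_nonneg {p : ℝ} (h0 : 0 ≤ p) (h1 : p ≤ 1) {n : ℕ} (Γ : SimpleGraph (Fin n)) :
    0 ≤ gnpWeight n p Γ :=
  mul_nonneg (pow_nonneg h0 _) (pow_nonneg (sub_nonneg.2 h1) _)

lemma gnpProb_nonneg {p : ℝ} (h0 : 0 ≤ p) (h1 : p ≤ 1) {n : ℕ} (A : SimpleGraph (Fin n) → Prop) :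
    0 ≤ gnpProb n p A :=
  Finset.sum_nonneg fun Γ _ => by
    split_ifs
    exacts [gnpWeight_nonneg h0 h1 Γ, le_rfl]

lemma gnpProb_le_sum {p : ℝ} (h0 : 0 ≤ p) (h1 : p ≤ 1) {n : ℕ} {κ : Type*} (s : Finset κ)
    (A : SimpleGraph (Fin n) → Prop) (B : κ → SimpleGraph (Fin n) → Prop)
    (h : ∀ Γ, A Γ → ∃ k ∈ s, B k Γ) : gnpProb n p A ≤ ∑ k ∈ s, gnpProb n p (B k) := by
  unfold gnpProb
  rw [Finset.sum_comm]
  refine Finset.sum_le_sum fun Γ _ => ?_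
  have hnn : ∀ k ∈ s, 0 ≤ if B k Γ then gnpWeight n p Γ else 0 := fun k _ => by
    split_ifs
    exacts [gnpWeight_nonneg h0 h1 Γ, le_rfl]
  split_ifs with hA
  · obtain ⟨k, hk, hB⟩ := h Γ hA
    simpa [hB] using Finset.single_le_sum hnn hk
  · exact Finset.sum_nonneg hnn

/-- Some fourth vertex is adjacent to `b` and `c` but not to `a`. -/
def HasSeparatingVertex {V : Type*} (Γ : SimpleGraph V) (a b c : V) : Prop :=
  ∃ u, u ≠ a ∧ u ≠ b ∧ u ≠ c ∧ ¬ Γ.Adj a u ∧ Γ.Adj b u ∧ Γ.Adj c u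

lemma gnpProb_not_hasSeparatingVertex (n : ℕ) (p : ℝ) {a b c : Fin n} (hab : a ≠ b) (hac : a ≠ c)
    (hbc : b ≠ c) :
    gnpProb n p (fun Γ => ¬ HasSeparatingVertex Γ a b c) = (1 - (1 - p) * p ^ 2) ^ (n - 3) := by
  let f : {u : Fin n // u ∉ ({a, b, c} : Finset (Fin n))} → Fin 3 → Sym2 (Fin n) :=
    fun u i => s(![a, b, c] i, u)
  have hf : Function.Injective2 f := by
    rintro ⟨u, hu⟩ ⟨v, hv⟩ i j h
    simp only [Finset.mem_insert, Finset.mem_singleton, not_or] at hu hv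
    fin_cases i <;> fin_cases j <;> simp [f] at h ⊢ <;> grind
  have hG : ∀ u ∈ (Finset.univ : Finset {u : Fin n // u ∉ ({a, b, c} : Finset (Fin n))}),
      ∀ i, f u i ∈ (⊤ : SimpleGraph (Fin n)).edgeFinset := by
    rintro ⟨u, hu⟩ - i
    simp only [Finset.mem_insert, Finset.mem_singleton, not_or] at hu
    fin_cases i <;> simp [f] <;> grind
  have key := randomSubsetExp_avoid p f hf Finset.univ _ hG
  have hcard : (Finset.univ : Finset {u : Fin n // u ∉ ({a, b, c} : Finset (Fin n))}).card
      = n - 3 := by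
    rw [Finset.card_univ, Fintype.card_subtype_compl, Fintype.card_fin, Fintype.card_coe,
      Finset.card_eq_three.2 ⟨a, b, c, hab, hac, hbc, rfl⟩]
  rw [gnpProb_eq_randomSubsetExp, ← hcard, ← key]
  refine randomSubsetExp_congr fun E _ => ?_
  congr 1
  simp only [HasSeparatingVertex, eq_iff_iff, SimpleGraph.fromEdgeSet_adj, f]
  constructor
  · rintro h ⟨u, hu⟩ - ⟨h0, h1, h2⟩
    simp only [Finset.mem_insert, Finset.mem_singleton, not_or] at hu
    exact h ⟨u, hu.1, hu.2.1, hu.2.2, fun h' => h0 h'.1, ⟨h1, Ne.symm hu.2.1⟩,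
      ⟨h2, Ne.symm hu.2.2⟩⟩
  · rintro h ⟨u, ha, hb, hc, h0, h1, h2⟩
    exact h ⟨u, by simp [ha, hb, hc]⟩ (Finset.mem_univ _)
      ⟨fun h' => h0 ⟨h', ha.symm⟩, h1.1, h2.1⟩

lemma not_linkSubsetStar_of_hasSeparatingVertex {V : Type*} {Γ : SimpleGraph V} {v w c : V}
    (h : HasSeparatingVertex Γ w v c) : ¬ LinkSubsetStar Γ v w := by
  obtain ⟨u, hw, -, -, hwu, hvu, -⟩ := h
  exact fun H => (H u hvu).elim hw hwu

lemma starTwoConnected_of_hasSeparatingVertex {n : ℕ} {Γ : SimpleGraph (Fin n)}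
    (h : ∀ a b c, a ≠ b → a ≠ c → b ≠ c → HasSeparatingVertex Γ a b c) : StarTwoConnected Γ := by
  rintro ⟨v, S, T, ⟨s, hs⟩, ⟨t, ht⟩, hST, hmem, hno⟩
  have hsv := (hmem s).1 (Finset.mem_union_left T hs)
  have htv := (hmem t).1 (Finset.mem_union_right S ht)
  obtain ⟨u, huv, -, -, hvu, hsu, htu⟩ := h v s t hsv.1.symm htv.1.symm
    (fun hst => Finset.disjoint_left.1 hST hs (hst ▸ ht))
  rcases Finset.mem_union.1 ((hmem u).2 ⟨huv, hvu⟩) with hu | hu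
  · exact hno u hu t ht htu.symm
  · exact hno s hs u hu hsu

lemma one_sub_le_gnpProb {p : ℝ} (h0 : 0 ≤ p) (h1 : p ≤ 1) {n : ℕ} (hn : 3 ≤ n) :
    1 - (n : ℝ) ^ 3 * (1 - (1 - p) * p ^ 2) ^ (n - 3) ≤
      gnpProb n p (fun Γ =>
        (∀ v w : Fin n, v ≠ w → ¬ LinkSubsetStar Γ v w) ∧ StarTwoConnected Γ) := by
  set A : SimpleGraph (Fin n) → Prop := fun Γ =>
    (∀ v w : Fin n, v ≠ w → ¬ LinkSubsetStar Γ v w) ∧ StarTwoConnected Γ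
  set q := 1 - (1 - p) * p ^ 2
  have hq : 0 ≤ q := by
    have : (1 - p) * p ^ 2 ≤ 1 := mul_le_one₀ (by linarith) (by positivity) (pow_le_one₀ h0 h1)
    simp only [q]
    linarith
  let s : Finset (Fin n × Fin n × Fin n) :=
    Finset.univ.filter fun t => t.1 ≠ t.2.1 ∧ t.1 ≠ t.2.2 ∧ t.2.1 ≠ t.2.2
  have hle : gnpProb n p (fun Γ => ¬ A Γ) ≤ ∑ t ∈ s, q ^ (n - 3) := by
    refine (gnpProb_le_sum h0 h1 s _
      (fun t Γ => ¬ HasSeparatingVertex Γ t.1 t.2.1 t.2.2) ?_).trans_eq ?_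
    · intro Γ hA
      by_contra! hcon
      have hsep : ∀ a b c, a ≠ b → a ≠ c → b ≠ c → HasSeparatingVertex Γ a b c :=
        fun a b c hab hac hbc => hcon (a, b, c) (by simp [s, hab, hac, hbc])
      refine hA ⟨fun v w hvw => ?_, starTwoConnected_of_hasSeparatingVertex hsep⟩
      obtain ⟨c, hc⟩ : ∃ c, c ∉ ({v, w} : Finset (Fin n)) := by
        by_contra! hall
        have := Finset.card_le_card (fun x _ => hall x : Finset.univ ⊆ ({v, w} : Finset (Fin n)))
        have := Finset.card_le_two (a := v) (b := w)
        simp only [Finset.card_univ, Fintype.card_fin] at *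
        omega
      simp only [Finset.mem_insert, Finset.mem_singleton, not_or] at hc
      exact not_linkSubsetStar_of_hasSeparatingVertex
        (hsep w v c hvw.symm (Ne.symm hc.2) (Ne.symm hc.1))
    · refine Finset.sum_congr rfl fun t ht => ?_
      obtain ⟨-, hab, hac, hbc⟩ := Finset.mem_filter.1 ht
      exact gnpProb_not_hasSeparatingVertex n p hab hac hbc
  have hs : (s.card : ℝ) ≤ (n : ℝ) ^ 3 := by
    have := Finset.card_le_univ s
    simp only [Fintype.card_prod, Fintype.card_fin] at this
    calc (s.card : ℝ) ≤ ((n * (n * n) : ℕ) : ℝ) := by exact_mod_cast this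
      _ = (n : ℝ) ^ 3 := by push_cast; ring
  rw [Finset.sum_const, nsmul_eq_mul] at hle
  have := gnpProb_add_gnpProb_not n p A
  have := mul_le_mul_of_nonneg_right hs (pow_nonneg hq (n - 3))
  linarith

lemma tendsto_cube_mul_pow_sub_three {q : ℝ} (h0 : 0 < q) (h1 : q < 1) :
    Tendsto (fun n : ℕ => (n : ℝ) ^ 3 * q ^ (n - 3)) atTop (nhds 0) := by
  have h := (tendsto_pow_const_mul_const_pow_of_abs_lt_one 3
    (by rwa [abs_of_pos h0] : |q| < 1)).div_const (q ^ 3)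
  rw [zero_div] at h
  refine h.congr' ?_
  filter_upwards [eventually_ge_atTop 3] with n hn
  rw [pow_sub₀ q h0.ne' hn]
  ring

/-- For constant `p` with `1 - 1/√2 < p < 1`, a.a.s. `Γ ∈ G(n,p)` has no ordered pair of
distinct vertices `(v,w)` with `lk(v) ⊆ st(w)` and is star 2-connected. -/
theorem gnp_aas_no_lk_star_pair_and_star_two_connected (p : ℝ)
    (h1 : 1 - 1 / Real.sqrt 2 < p) (h2 : p < 1) :
    Tendsto (fun n : ℕ =>
      gnpProb n p (fun Γ =>
        (∀ v w : Fin n, v ≠ w → ¬ LinkSubsetStar Γ v w) ∧ StarTwoConnected Γ))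
      atTop (nhds 1) := by
  have hp : 0 < p := by
    have : 1 / Real.sqrt 2 ≤ 1 := by
      rw [div_le_one (by positivity)]
      exact Real.one_le_sqrt.2 one_le_two
    linarith
  have hpos : 0 < (1 - p) * p ^ 2 := mul_pos (by linarith) (by positivity)
  have hlt : (1 - p) * p ^ 2 < 1 :=
    mul_lt_one_of_nonneg_of_lt_one_left (by linarith) (by linarith) (pow_le_one₀ hp.le h2.le)
  have hlim := (tendsto_cube_mul_pow_sub_three
    (by linarith : 0 < 1 - (1 - p) * p ^ 2) (by linarith)).const_sub 1
  rw [sub_zero] at hlim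
  refine tendsto_of_tendsto_of_tendsto_of_le_of_le' hlim tendsto_const_nhds ?_ ?_
  · filter_upwards [eventually_ge_atTop 3] with n hn using one_sub_le_gnpProb hp.le h2.le hn
  · refine Eventually.of_forall fun n => ?_
    rw [← gnpProb_add_gnpProb_not n p]
    exact le_add_of_nonneg_right (gnpProb_nonneg hp.le h2.le _)
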